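/- Let (V, ω) be a simple VOA of strong CFT type over ℝ whose invariant bilinear form is positive-definite. Then the set of conformal vectors of V is CV = {(1/2)a(1)a + a + ω + Tb | a, b ∈ J_1(V)}, and Aut V = Aut⁻V ⋊ Aut_ω V. In particular, if J_1(V) = 0, then CV = {ω} and Aut V = Aut_ω V. -/

import Mathlib

/-!
Common framework: vertex algebras, ℤ-graded (conformal) vertex algebras,
conformal vectors, automorphism groups, following Moriwaki,
"On classification of conformal vectors in vertex operator algebra and
the vertex algebra automorphism group".
-/

noncomputable section

open scoped BigOperators

/-- The generalized binomial coefficient `binom(m, i)` for `m : ℤ`, valued in a field `K`. -/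
def zBinom (K : Type*) [Field K] (m : ℤ) (i : ℕ) : K :=
  (∏ j ∈ Finset.range i, ((m : K) - (j : K))) / (Nat.factorial i : K)

/-- A vertex algebra over a field `K`: a `K`-vector space `V` equipped with bilinear
`n`-th products `a(n)b` (`n : ℤ`) and a vacuum vector `𝟙`, subject to the truncation
condition, the vacuum and creation axioms, and the Borcherds identity. -/
structure VA (K V : Type*) [Field K] [AddCommGroup V] [Module K V] where
  /-- the `n`-th product `a(n)b`, bilinear in `a` and `b` -/
  ncoef : ℤ → V →ₗ[K] V →ₗ[K] V
  /-- the vacuum vector `𝟙` -/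
  vac : V
  /-- truncation: `a(n)b = 0` for `n` sufficiently large -/
  trunc : ∀ a b : V, ∃ N : ℤ, ∀ n : ℤ, N ≤ n → ncoef n a b = 0
  /-- the vacuum axiom `Y(𝟙, z) = id`, i.e. `𝟙(n)a = δ_{n,-1} a` -/
  vac_ncoef : ∀ (n : ℤ) (a : V), ncoef n vac a = if n = -1 then a else 0
  /-- creation: `a(-1)𝟙 = a` -/
  ncoef_vac : ∀ a : V, ncoef (-1) a vac = a
  /-- creation: `a(n)𝟙 = 0` for `n ≥ 0` -/
  ncoef_vac_zero : ∀ n : ℤ, 0 ≤ n → ∀ a : V, ncoef n a vac = 0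
  /-- the Borcherds identity -/
  borcherds : ∀ (a b c : V) (p q m : ℤ),
    (∑ᶠ i : ℕ, zBinom K m i •
        ncoef (m + q - (i : ℤ)) (ncoef (p + (i : ℤ)) a b) c)
      = ∑ᶠ i : ℕ, ((-1 : K) ^ i * zBinom K p i) •
          (ncoef (m + p - (i : ℤ)) a (ncoef (q + (i : ℤ)) b c)
            - ((p.negOnePow : ℤ) : K) •
                ncoef (p + q - (i : ℤ)) b (ncoef (m + (i : ℤ)) a c))

namespace VA

variable {K V : Type*} [Field K] [AddCommGroup V] [Module K V]

/-- The translation operator `T a = a(-2)𝟙`. -/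
def T (A : VA K V) : V →ₗ[K] V := (A.ncoef (-2)).flip A.vac

/-- The eigenspace `V_n^a = {v ∈ V | a(1)v = n v}` of `a(1)`. -/
def eig (A : VA K V) (a : V) (n : ℤ) : Submodule K V :=
  LinearMap.ker (A.ncoef 1 a - (n : K) • (LinearMap.id : V →ₗ[K] V))

/-- `a` is a conformal vector: `a(1)a = 2a`, `a(3)a ∈ K𝟙`, `a(2)a = 0`, `a(n)a = 0`
for `n ≥ 4`, `a(0) = T`, and `a(1)` is semisimple with integer eigenvalues
(`V = ⊕_{n ∈ ℤ} V_n^a`). -/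
def IsConformal (A : VA K V) (a : V) : Prop :=
  A.ncoef 1 a a = (2 : K) • a ∧
  (∃ c : K, A.ncoef 3 a a = c • A.vac) ∧
  A.ncoef 2 a a = 0 ∧
  (∀ n : ℤ, 4 ≤ n → A.ncoef n a a = 0) ∧
  A.ncoef 0 a = A.T ∧
  DirectSum.IsInternal (A.eig a)

/-- `a` is a conformal vector of CFT type: `(V, a)` is a VOA of CFT type, i.e.
`V = ⊕_{n ∈ ℕ} V_n^a` with finite-dimensional pieces and `V_0^a = K𝟙`. -/
def IsConformalCFT (A : VA K V) (a : V) : Prop :=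
  A.IsConformal a ∧
  (∀ n : ℤ, n < 0 → A.eig a n = ⊥) ∧
  (∀ n : ℤ, FiniteDimensional K (A.eig a n)) ∧
  A.eig a 0 = Submodule.span K {A.vac}

/-- `a` is a conformal vector of strong CFT type: of CFT type and `a(2)V_1^a = 0`
(i.e. `L^a(1) V_1^a = 0`). -/
def IsConformalSCFT (A : VA K V) (a : V) : Prop :=
  A.IsConformalCFT a ∧ ∀ v ∈ A.eig a 1, A.ncoef 2 a v = 0

/-- A vertex algebra homomorphism: a linear map preserving all products and the vacuum. -/
structure IsVAHom (A : VA K V) (f : V → V) : Prop where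
  map_add : ∀ a b : V, f (a + b) = f a + f b
  map_smul : ∀ (c : K) (a : V), f (c • a) = c • f a
  map_ncoef : ∀ (n : ℤ) (a b : V), f (A.ncoef n a b) = A.ncoef n (f a) (f b)
  map_vac : f A.vac = A.vac

/-- A vertex algebra automorphism: a bijective vertex algebra homomorphism. -/
def IsVAAut (A : VA K V) (f : V → V) : Prop :=
  A.IsVAHom f ∧ Function.Bijective f

/-- A (two-sided) ideal of a vertex algebra. -/
def IsIdeal (A : VA K V) (I : Submodule K V) : Prop :=
  ∀ (n : ℤ) (a : V), ∀ b ∈ I, A.ncoef n a b ∈ I ∧ A.ncoef n b a ∈ I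

/-- A vertex algebra is simple if it has no ideals other than `0` and itself. -/
def IsSimple (A : VA K V) : Prop :=
  ∀ I : Submodule K V, A.IsIdeal I → I = ⊥ ∨ I = ⊤

end VA

/-- The exponential `exp f = Σ_{n≥0} f^n / n!` of an endomorphism, as a function
(meaningful for locally nilpotent `f`). -/
def expOp {K V : Type*} [Field K] [AddCommGroup V] [Module K V]
    (f : V →ₗ[K] V) (v : V) : V :=
  ∑ᶠ n : ℕ, (Nat.factorial n : K)⁻¹ • (f ^ n) v

/-- A ℤ-grading on a vertex algebra, making it a ℤ-graded vertex algebra: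
`V = ⊕_{n ∈ ℤ} V_n`, `V_n(k)V_m ⊆ V_{n+m-k-1}` and `𝟙 ∈ V_0`. -/
structure GradedVA {K V : Type*} [Field K] [AddCommGroup V] [Module K V] (A : VA K V) where
  /-- the grading subspaces `V_n` -/
  gr : ℤ → Submodule K V
  /-- `V = ⊕_{n ∈ ℤ} V_n` -/
  decomp : DirectSum.Decomposition gr
  /-- `𝟙 ∈ V_0` -/
  vac_mem : A.vac ∈ gr 0
  /-- `V_n(k)V_m ⊆ V_{n+m-k-1}` -/
  ncoef_mem : ∀ (n m k : ℤ), ∀ a ∈ gr n, ∀ b ∈ gr m, A.ncoef k a b ∈ gr (n + m - k - 1)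

namespace GradedVA

variable {K V : Type*} [Field K] [AddCommGroup V] [Module K V] {A : VA K V}

/-- The canonical projection `pr_n : V → V_n`. -/
def pr (G : GradedVA A) (n : ℤ) (v : V) : V :=
  letI := G.decomp
  (DirectSum.decompose G.gr v n : V)

/-- `V_{≥n} = ⊕_{i ≥ n} V_i`. -/
def ge (G : GradedVA A) (n : ℤ) : Submodule K V := ⨆ i ≥ n, G.gr i

/-- `V_{≤n} = ⊕_{i ≤ n} V_i`. -/
def le (G : GradedVA A) (n : ℤ) : Submodule K V := ⨆ i ≤ n, G.gr i

/-- `J_1(V) = {a ∈ V_1 | a(0) = 0}`. -/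
def J1 (G : GradedVA A) : Set V :=
  {a : V | a ∈ G.gr 1 ∧ A.ncoef 0 a = 0}

/-- `Aut⁺V`: automorphisms `f` with `f(V_n) ⊆ V_{≥n}` and `pr_n ∘ f|_{V_n} = id`. -/
def AutPlus (G : GradedVA A) (f : V → V) : Prop :=
  A.IsVAAut f ∧ ∀ n : ℤ, ∀ v ∈ G.gr n, f v ∈ G.ge n ∧ G.pr n (f v) = v

/-- `Aut⁻V`: automorphisms `f` with `f(V_n) ⊆ ⊕_{k ≤ n} V_k` and `pr_n ∘ f|_{V_n} = id`. -/
def AutMinus (G : GradedVA A) (f : V → V) : Prop :=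
  A.IsVAAut f ∧ ∀ n : ℤ, ∀ v ∈ G.gr n, f v ∈ G.le n ∧ G.pr n (f v) = v

/-- `Aut⁰V`: automorphisms `f` with `f(V_n) ⊆ V_n`. -/
def AutZero (G : GradedVA A) (f : V → V) : Prop :=
  A.IsVAAut f ∧ ∀ n : ℤ, ∀ v ∈ G.gr n, f v ∈ G.gr n

end GradedVA

/-- A ℤ-graded conformal vertex algebra: a ℤ-graded vertex algebra with a conformal
vector `ω ∈ V_2` whose modes `L(n) = ω(n+1)` satisfy the Virasoro relations, with
`L(0)v = n v` for `v ∈ V_n` and `L(-1) = T`. -/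
structure ConfGVA {K V : Type*} [Field K] [AddCommGroup V] [Module K V] (A : VA K V)
    extends GradedVA A where
  /-- the conformal vector -/
  ω : V
  ω_mem : ω ∈ gr 2
  /-- the Virasoro relations `[L(n), L(m)] = (n-m)L(n+m) + δ_{n+m,0}((n³-n)/12)c` -/
  virasoro : ∃ c : K, ∀ n m : ℤ,
    A.ncoef (n + 1) ω ∘ₗ A.ncoef (m + 1) ω - A.ncoef (m + 1) ω ∘ₗ A.ncoef (n + 1) ω
      = ((n : K) - (m : K)) • A.ncoef (n + m + 1) ω
        + (if n + m = 0 then ((n : K) ^ 3 - (n : K)) / 12 * c else 0)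
            • (LinearMap.id : V →ₗ[K] V)
  /-- `L(0) v = n v` for `v ∈ V_n` -/
  L0_grading : ∀ n : ℤ, ∀ v ∈ gr n, A.ncoef 1 ω v = (n : K) • v
  /-- `L(-1) = T` -/
  Lneg1_eq_T : A.ncoef 0 ω = A.T

namespace ConfGVA

variable {K V : Type*} [Field K] [AddCommGroup V] [Module K V] {A : VA K V}

abbrev pr (C : ConfGVA A) : ℤ → V → V := C.toGradedVA.pr
abbrev ge (C : ConfGVA A) : ℤ → Submodule K V := C.toGradedVA.ge
abbrev le (C : ConfGVA A) : ℤ → Submodule K V := C.toGradedVA.le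
abbrev J1 (C : ConfGVA A) : Set V := C.toGradedVA.J1
abbrev AutPlus (C : ConfGVA A) : (V → V) → Prop := C.toGradedVA.AutPlus
abbrev AutMinus (C : ConfGVA A) : (V → V) → Prop := C.toGradedVA.AutMinus
abbrev AutZero (C : ConfGVA A) : (V → V) → Prop := C.toGradedVA.AutZero

/-- `Aut_ω V`: the VOA automorphisms, i.e. the stabilizer of `ω` in `Aut V`. -/
def AutOmega (C : ConfGVA A) (f : V → V) : Prop :=
  A.IsVAAut f ∧ f C.ω = C.ω

/-- An invariant bilinear form on `(V, ω)`:
`(a(n)b, c) = (-1)^d Σ_{j≥0} (1/j!) (b, (L(1)^j a)(2d-n-2-j) c)` for `a ∈ V_d`, which is the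
coefficient form of `(Y(a,z)b, c) = (b, Y(e^{zL(1)}(-z^{-2})^{L(0)} a, z^{-1}) c)`. -/
def IsInvForm (C : ConfGVA A) (B : V →ₗ[K] V →ₗ[K] K) : Prop :=
  ∀ d : ℤ, ∀ a ∈ C.gr d, ∀ (b c : V) (n : ℤ),
    B (A.ncoef n a b) c
      = ((d.negOnePow : ℤ) : K) *
          ∑ᶠ j : ℕ, (Nat.factorial j : K)⁻¹ *
            B b (A.ncoef (2 * d - n - 2 - (j : ℤ)) ((A.ncoef 2 C.ω ^ j) a) c)

end ConfGVA

/-- A VOA of CFT type: a ℤ-graded conformal vertex algebra with `V = ⊕_{n ∈ ℕ} V_n`,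
`dim V_n < ∞`, and `V_0 = K𝟙`. -/
structure VOACFT {K V : Type*} [Field K] [AddCommGroup V] [Module K V] (A : VA K V)
    extends ConfGVA A where
  gr_neg : ∀ n : ℤ, n < 0 → gr n = ⊥
  gr_fd : ∀ n : ℤ, FiniteDimensional K (gr n)
  gr_zero : gr 0 = Submodule.span K {A.vac}

namespace VOACFT

variable {K V : Type*} [Field K] [AddCommGroup V] [Module K V] {A : VA K V}

abbrev pr (W : VOACFT A) : ℤ → V → V := W.toConfGVA.pr
abbrev ge (W : VOACFT A) : ℤ → Submodule K V := W.toConfGVA.ge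
abbrev le (W : VOACFT A) : ℤ → Submodule K V := W.toConfGVA.le
abbrev J1 (W : VOACFT A) : Set V := W.toConfGVA.J1
abbrev AutPlus (W : VOACFT A) : (V → V) → Prop := W.toConfGVA.AutPlus
abbrev AutMinus (W : VOACFT A) : (V → V) → Prop := W.toConfGVA.AutMinus
abbrev AutZero (W : VOACFT A) : (V → V) → Prop := W.toConfGVA.AutZero
abbrev AutOmega (W : VOACFT A) : (V → V) → Prop := W.toConfGVA.AutOmega
abbrev IsInvForm (W : VOACFT A) : (V →ₗ[K] V →ₗ[K] K) → Prop := W.toConfGVA.IsInvForm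

end VOACFT

/-- A VOA of strong CFT type: a VOA of CFT type with `L(1)V_1 = 0`. -/
structure VOAsCFT {K V : Type*} [Field K] [AddCommGroup V] [Module K V] (A : VA K V)
    extends VOACFT A where
  L1_V1 : ∀ v ∈ gr 1, A.ncoef 2 ω v = 0

namespace VOAsCFT

variable {K V : Type*} [Field K] [AddCommGroup V] [Module K V] {A : VA K V}

abbrev pr (W : VOAsCFT A) : ℤ → V → V := W.toVOACFT.pr
abbrev ge (W : VOAsCFT A) : ℤ → Submodule K V := W.toVOACFT.ge
abbrev le (W : VOAsCFT A) : ℤ → Submodule K V := W.toVOACFT.le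
abbrev J1 (W : VOAsCFT A) : Set V := W.toVOACFT.J1
abbrev AutPlus (W : VOAsCFT A) : (V → V) → Prop := W.toVOACFT.AutPlus
abbrev AutMinus (W : VOAsCFT A) : (V → V) → Prop := W.toVOACFT.AutMinus
abbrev AutZero (W : VOAsCFT A) : (V → V) → Prop := W.toVOACFT.AutZero
abbrev AutOmega (W : VOAsCFT A) : (V → V) → Prop := W.toVOACFT.AutOmega
abbrev IsInvForm (W : VOAsCFT A) : (V →ₗ[K] V →ₗ[K] K) → Prop := W.toVOACFT.IsInvForm

end VOAsCFT

end

namespace GradedVA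

variable {K V : Type*} [Field K] [AddCommGroup V] [Module K V] {A : VA K V}

/-- The projection `pr n` as a linear endomorphism. -/
def prL (G : GradedVA A) (n : ℤ) : V →ₗ[K] V :=
  letI := G.decomp
  (G.gr n).subtype ∘ₗ DirectSum.component K ℤ (fun i => G.gr i) n ∘ₗ
    (DirectSum.decomposeLinearEquiv G.gr).toLinearMap

theorem prL_apply (G : GradedVA A) (n : ℤ) (v : V) : G.prL n v = G.pr n v := rfl

theorem prL_mem (G : GradedVA A) (n : ℤ) (v : V) : G.prL n v ∈ G.gr n := by
  let := G.decomp
  exact (DirectSum.decompose G.gr v n).2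

theorem prL_of_mem (G : GradedVA A) {n : ℤ} {v : V} (hv : v ∈ G.gr n) : G.prL n v = v := by
  let := G.decomp
  exact DirectSum.decompose_of_mem_same G.gr hv

theorem prL_of_mem_ne (G : GradedVA A) {n m : ℤ} {v : V} (hv : v ∈ G.gr n) (h : n ≠ m) :
    G.prL m v = 0 := by
  let := G.decomp
  exact DirectSum.decompose_of_mem_ne G.gr hv h

theorem iSup_gr (G : GradedVA A) : ⨆ n, G.gr n = ⊤ := by
  let := G.decomp
  exact (DirectSum.Decomposition.isInternal G.gr).submodule_iSup_eq_top

/-- Induction over homogeneous elements. -/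
theorem hom_induction (G : GradedVA A) {p : V → Prop}
    (hom : ∀ n : ℤ, ∀ v ∈ G.gr n, p v) (zero : p 0)
    (h_add : ∀ v w, p v → p w → p (v + w)) (v : V) : p v :=
  Submodule.iSup_induction (motive := p) G.gr (G.iSup_gr ▸ Submodule.mem_top : v ∈ ⨆ n, G.gr n)
    hom zero h_add

theorem linearMap_ext (G : GradedVA A) {f g : V →ₗ[K] V}
    (h : ∀ n : ℤ, ∀ v ∈ G.gr n, f v = g v) : f = g := by
  ext v
  refine G.hom_induction h (by simp) (fun v w hv hw => ?_) v
  simp [hv, hw]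

theorem eq_zero_of_mem_of_mem (G : GradedVA A) {n m : ℤ} (h : n ≠ m) {v : V}
    (hn : v ∈ G.gr n) (hm : v ∈ G.gr m) : v = 0 := by
  rw [← G.prL_of_mem hm, G.prL_of_mem_ne hn h]

theorem eq_zero_of_forall_prL (G : GradedVA A) {v : V} (h : ∀ n, G.prL n v = 0) : v = 0 := by
  let := G.decomp
  refine (DirectSum.decompose G.gr).injective (DFinsupp.ext fun n => Subtype.ext ?_)
  rw [DirectSum.decompose_zero]
  exact h n

theorem gr_le_le (G : GradedVA A) {i n : ℤ} (h : i ≤ n) : G.gr i ≤ G.le n :=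
  le_iSup₂_of_le i h le_rfl

theorem le_mono (G : GradedVA A) {m n : ℤ} (h : m ≤ n) : G.le m ≤ G.le n :=
  iSup₂_le fun _ hi => G.gr_le_le (hi.trans h)

/-- Induction over homogeneous elements of degree at most `n`. -/
theorem le_induction (G : GradedVA A) {n : ℤ} {p : V → Prop}
    (hom : ∀ i ≤ n, ∀ v ∈ G.gr i, p v) (zero : p 0)
    (h_add : ∀ v w, p v → p w → p (v + w)) {v : V} (hv : v ∈ G.le n) : p v := by
  refine Submodule.iSup_induction (motive := p) _ hv (fun i w hw => ?_) zero h_add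
  refine Submodule.iSup_induction (motive := p) _ hw (fun hi u hu => hom i hi u hu) zero h_add

theorem prL_of_mem_le (G : GradedVA A) {n m : ℤ} (h : n < m) {v : V} (hv : v ∈ G.le n) :
    G.prL m v = 0 := by
  refine G.le_induction (p := fun v => G.prL m v = 0)
    (fun i hi v hv => G.prL_of_mem_ne hv (by omega)) (by simp) ?_ hv
  intro v w hv hw
  simp [hv, hw]

theorem sub_prL_mem_le (G : GradedVA A) {n : ℤ} {v : V} (hv : v ∈ G.le n) :
    v - G.prL n v ∈ G.le (n - 1) := by
  refine G.le_induction (p := fun v => v - G.prL n v ∈ G.le (n - 1)) ?_ (by simp) ?_ hv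
  · intro i hi w hw
    rcases hi.eq_or_lt with rfl | hi
    · rw [G.prL_of_mem hw, sub_self]
      exact zero_mem _
    · rw [G.prL_of_mem_ne hw hi.ne, sub_zero]
      exact G.gr_le_le (by omega) hw
  · intro v w hv hw
    rw [map_add, add_sub_add_comm]
    exact add_mem hv hw

theorem exists_mem_le (G : GradedVA A) (v : V) : ∃ n, v ∈ G.le n := by
  refine G.hom_induction (p := fun v => ∃ n, v ∈ G.le n)
    (fun n v hv => ⟨n, G.gr_le_le le_rfl hv⟩) ⟨0, zero_mem _⟩ ?_ v
  rintro v w ⟨n, hv⟩ ⟨m, hw⟩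
  exact ⟨max n m, add_mem (G.le_mono (le_max_left _ _) hv) (G.le_mono (le_max_right _ _) hw)⟩

/-- A vector outside `V_{≤n}` has a leading component of degree greater than `n`. -/
theorem exists_top_of_not_mem_le (G : GradedVA A) {n : ℤ} {v : V} (hv : v ∉ G.le n) :
    ∃ m, n < m ∧ v ∈ G.le m ∧ G.prL m v ≠ 0 := by
  obtain ⟨N, hN⟩ := G.exists_mem_le v
  have key : ∀ k : ℕ, v ∈ G.le (n + k) → ∃ m, n < m ∧ v ∈ G.le m ∧ G.prL m v ≠ 0 := by
    intro k
    induction k with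
    | zero => intro h; exact absurd (by simpa using h) hv
    | succ k ih =>
      intro h
      by_cases h0 : G.prL (n + (k + 1 : ℕ)) v = 0
      · have := G.sub_prL_mem_le h
        rw [h0, sub_zero] at this
        exact ih (by convert this using 2; push_cast; ring)
      · exact ⟨_, by push_cast; omega, h, h0⟩
  exact key (N - n).toNat (G.le_mono (by omega) hN)

theorem ncoef_mem_le (G : GradedVA A) {m n : ℤ} (k : ℤ) {v w : V} (hv : v ∈ G.le m)
    (hw : w ∈ G.le n) : A.ncoef k v w ∈ G.le (m + n - k - 1) := by
  refine G.le_induction (p := fun v => A.ncoef k v w ∈ G.le (m + n - k - 1)) ?_ (by simp) ?_ hv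
  · intro i hi v hv
    refine G.le_induction (p := fun w => A.ncoef k v w ∈ G.le (m + n - k - 1)) ?_ (by simp) ?_ hw
    · intro j hj w hw
      exact G.gr_le_le (by omega) (G.ncoef_mem i j k v hv w hw)
    · intro w w' h h'
      rw [map_add]
      exact add_mem h h'
  · intro v v' h h'
    rw [map_add, LinearMap.add_apply]
    exact add_mem h h'

/-- The leading component of a product is the product of the leading components. -/
theorem prL_ncoef (G : GradedVA A) {m n k l : ℤ} (hl : l = m + n - k - 1) {v w : V}
    (hv : v ∈ G.le m) (hw : w ∈ G.le n) :
    G.prL l (A.ncoef k v w) = A.ncoef k (G.prL m v) (G.prL n w) := by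
  have hv' := G.sub_prL_mem_le hv
  have hw' := G.sub_prL_mem_le hw
  have h1 := G.prL_of_mem_le (m := l) (by omega) (G.ncoef_mem_le k hv' hw)
  have h2 := G.prL_of_mem_le (m := l) (by omega)
    (G.ncoef_mem_le k (G.gr_le_le le_rfl (G.prL_mem m v)) hw')
  have h3 := G.prL_of_mem (G.ncoef_mem m n k _ (G.prL_mem m v) _ (G.prL_mem n w))
  rw [← hl] at h3
  rw [← h3]
  rw [map_sub, LinearMap.sub_apply, map_sub, sub_eq_zero] at h1
  rw [map_sub, map_sub, sub_eq_zero] at h2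
  rw [h1, h2]

/-- The degree-preserving part of an endomorphism. -/
def diag (G : GradedVA A) (f : V →ₗ[K] V) : V →ₗ[K] V :=
  letI := G.decomp
  DirectSum.toModule K ℤ V (fun n => G.prL n ∘ₗ f ∘ₗ (G.gr n).subtype) ∘ₗ
    (DirectSum.decomposeLinearEquiv G.gr).toLinearMap

theorem diag_of_mem (G : GradedVA A) (f : V →ₗ[K] V) {n : ℤ} {v : V} (hv : v ∈ G.gr n) :
    G.diag f v = G.prL n (f v) := by
  let := G.decomp
  rw [diag, LinearMap.comp_apply, LinearEquiv.coe_coe, DirectSum.decomposeLinearEquiv_apply,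
    DirectSum.decompose_of_mem G.gr hv]
  exact DirectSum.toModule_lof (M := fun i => G.gr i)
    (φ := fun n => G.prL n ∘ₗ f ∘ₗ (G.gr n).subtype) K n ⟨v, hv⟩

end GradedVA

namespace VA

variable {K V : Type*} [Field K] [AddCommGroup V] [Module K V]

theorem zBinom_zero (m : ℤ) : zBinom K m 0 = 1 := by simp [zBinom]

theorem zBinom_natCast_of_lt {m i : ℕ} (h : m < i) : zBinom K (m : ℤ) i = 0 := by
  rw [zBinom, Finset.prod_eq_zero (Finset.mem_range.2 h) (by simp), zero_div]

theorem zBinom_neg_one [CharZero K] (i : ℕ) : zBinom K (-1) i = (-1) ^ i := by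
  have : ∀ i : ℕ, ∏ j ∈ Finset.range i, (((-1 : ℤ) : K) - (j : K)) = (-1) ^ i * i.factorial := by
    intro i
    induction i with
    | zero => simp
    | succ i ih => rw [Finset.prod_range_succ, ih, Nat.factorial_succ]; push_cast; ring
  rw [zBinom, this, mul_div_assoc, div_self (by exact_mod_cast i.factorial_ne_zero), mul_one]

theorem zBinom_neg_two [CharZero K] (i : ℕ) : zBinom K (-2) i = (-1) ^ i * (i + 1) := by
  have : ∀ i : ℕ, ∏ j ∈ Finset.range i, (((-2 : ℤ) : K) - (j : K)) =
      (-1) ^ i * (i + 1) * i.factorial := by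
    intro i
    induction i with
    | zero => simp
    | succ i ih => rw [Finset.prod_range_succ, ih, Nat.factorial_succ]; push_cast; ring
  rw [zBinom, this, mul_div_assoc, div_self (by exact_mod_cast i.factorial_ne_zero), mul_one]

/-- The commutator formula for `a(0)`. -/
theorem ncoef_zero_comm (A : VA K V) (a b c : V) (q : ℤ) :
    A.ncoef 0 a (A.ncoef q b c) = A.ncoef q (A.ncoef 0 a b) c + A.ncoef q b (A.ncoef 0 a c) := by
  have h := A.borcherds a b c 0 q 0
  rw [finsum_eq_single _ 0, finsum_eq_single _ 0] at h
  · simp [zBinom_zero] at h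
    rw [h]; abel
  · intro i hi
    have := zBinom_natCast_of_lt (K := K) (m := 0) (i := i) (by omega)
    simp only [Nat.cast_zero] at this
    rw [this]; simp
  · intro i hi
    have := zBinom_natCast_of_lt (K := K) (m := 0) (i := i) (by omega)
    simp only [Nat.cast_zero] at this
    rw [this]; simp

/-- `(Ta)(n) = -n a(n-1)`. -/
theorem ncoef_T [CharZero K] (A : VA K V) (a c : V) (q : ℤ) :
    A.ncoef q (A.T a) c = -(q : K) • A.ncoef (q - 1) a c := by
  have h := A.borcherds a A.vac c (-2) q 0
  rw [finsum_eq_single _ 0] at h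
  swap
  · intro i hi
    have := zBinom_natCast_of_lt (K := K) (m := 0) (i := i) (by omega)
    simp only [Nat.cast_zero] at this
    rw [this]; simp
  simp only [zBinom_zero, one_smul, Nat.cast_zero, add_zero, zero_add, sub_zero] at h
  change A.ncoef q (A.ncoef (-2) a A.vac) c = _
  rw [h]
  simp only [A.vac_ncoef, zBinom_neg_two]
  have hs : ((-2 : ℤ).negOnePow : ℤ) = 1 := by decide
  rcases lt_trichotomy q 0 with hq | rfl | hq
  · rw [finsum_eq_single _ (-1 - q).toNat]
    · have h1 : ((-1 - q).toNat : ℤ) = -1 - q := by omega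
      have h2 : ((-1 - q).toNat : K) = -1 - q := by exact_mod_cast congrArg (Int.cast (R := K)) h1
      rw [h1, if_pos (by ring), if_neg (by omega), h2, ← mul_assoc, ← mul_pow]
      simp only [neg_mul_neg, mul_one, one_pow, one_mul, smul_zero, sub_zero]
      congr 2
      · ring
      · ring_nf
    · intro i hi
      rw [if_neg (by omega), if_neg (by omega)]; simp
  · rw [finsum_eq_zero_of_forall_eq_zero]
    · simp
    · intro i
      rw [if_neg (by omega), if_neg (by omega)]; simp
  · rw [finsum_eq_single _ (q - 1).toNat]
    · have h1 : ((q - 1).toNat : ℤ) = q - 1 := by omega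
      have h2 : ((q - 1).toNat : K) = q - 1 := by exact_mod_cast congrArg (Int.cast (R := K)) h1
      rw [h1, if_neg (by omega), if_pos (by ring), h2, ← mul_assoc, ← mul_pow, hs]
      simp
    · intro i hi
      rw [if_neg (by omega), if_neg (by omega)]; simp

theorem T_pow (A : VA K V) [CharZero K] (j : ℕ) (a : V) :
    (A.T ^ j) a = (j.factorial : K) • A.ncoef (-1 - (j : ℤ)) a A.vac := by
  induction j generalizing a with
  | zero => simp [A.ncoef_vac]
  | succ j ih =>
    rw [pow_succ, Module.End.mul_apply, ih, ncoef_T, smul_smul, Nat.factorial_succ]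
    congr 2
    · push_cast; ring
    · push_cast; ring_nf

/-- Skew-symmetry. -/
theorem skew [CharZero K] (A : VA K V) (a b : V) (p : ℤ) (N : ℕ)
    (h : ∀ i : ℕ, N ≤ i → A.ncoef (p + i) a b = 0) :
    A.ncoef p b a = -((p.negOnePow : ℤ) : K) • ∑ i ∈ Finset.range N,
      ((-1 : K) ^ i) • A.ncoef (-1 - (i : ℤ)) (A.ncoef (p + i) a b) A.vac := by
  have hb := A.borcherds a b A.vac p 0 (-1)
  rw [finsum_eq_sum_of_support_subset (s := Finset.range N)] at hb
  swap
  · intro i hi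
    by_contra hN
    exact hi (by simp [h i (by simpa using hN)])
  rw [finsum_eq_single _ 0] at hb
  swap
  · intro i hi
    rw [A.ncoef_vac_zero (0 + i) (by omega), A.ncoef_vac_zero (-1 + i) (by omega)]
    simp
  simp only [zBinom_neg_one, zBinom_zero, add_zero] at hb
  rw [hb]
  have hs : ((p.negOnePow : ℤ) : K) * ((p.negOnePow : ℤ) : K) = 1 := by
    rcases Int.even_or_odd p with hp | hp
    · simp [Int.negOnePow_even p hp]
    · simp [Int.negOnePow_odd p hp]
  rw [A.ncoef_vac_zero _ (by simp), map_zero, zero_sub, Nat.cast_zero, add_zero, sub_zero,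
    A.ncoef_vac, pow_zero, one_mul, one_smul, smul_neg, neg_smul, neg_neg, smul_smul, hs, one_smul]

end VA

namespace GradedVA

variable {K V : Type*} [Field K] [AddCommGroup V] [Module K V] {A : VA K V}

theorem ncoef_mem_of_eq (G : GradedVA A) {n m k l : ℤ} {a b : V} (ha : a ∈ G.gr n)
    (hb : b ∈ G.gr m) (h : l = n + m - k - 1) : A.ncoef k a b ∈ G.gr l :=
  h ▸ G.ncoef_mem n m k a ha b hb

theorem T_mem (G : GradedVA A) {n : ℤ} {a : V} (ha : a ∈ G.gr n) : A.T a ∈ G.gr (n + 1) :=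
  G.ncoef_mem_of_eq ha G.vac_mem (by ring)

end GradedVA

namespace VOAsCFT

section General

variable {K V : Type*} [Field K] [AddCommGroup V] [Module K V] {A : VA K V}

theorem eq_zero_of_neg (W : VOAsCFT A) {n : ℤ} (h : n < 0) {v : V} (hv : v ∈ W.gr n) : v = 0 := by
  rwa [W.gr_neg n h, Submodule.mem_bot] at hv

theorem ncoef_eq_zero (W : VOAsCFT A) {n m k : ℤ} {a b : V} (ha : a ∈ W.gr n)
    (hb : b ∈ W.gr m) (h : n + m - k - 1 < 0) : A.ncoef k a b = 0 :=
  W.eq_zero_of_neg h (W.ncoef_mem n m k a ha b hb)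

theorem eq_zero_of_mem_le (W : VOAsCFT A) {n : ℤ} (h : n < 0) {v : V}
    (hv : v ∈ W.toGradedVA.le n) : v = 0 :=
  W.toGradedVA.le_induction (p := fun v => v = 0)
    (fun i hi _ hv => W.eq_zero_of_neg (by omega) hv) rfl
    (fun v w hv hw => by rw [hv, hw, add_zero]) hv

theorem exists_smul_vac (W : VOAsCFT A) {v : V} (hv : v ∈ W.gr 0) : ∃ c : K, c • A.vac = v := by
  rwa [W.gr_zero, Submodule.mem_span_singleton] at hv

theorem ncoef_degree_zero (W : VOAsCFT A) {v : V} (hv : v ∈ W.gr 0) {k : ℤ} (hk : k ≠ -1) :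
    A.ncoef k v = 0 := by
  obtain ⟨c, rfl⟩ := W.exists_smul_vac hv
  ext w
  simp [A.vac_ncoef, hk]

theorem ncoef_apply_degree_zero (W : VOAsCFT A) {v : V} (hv : v ∈ W.gr 0) {k : ℤ} (hk : 0 ≤ k)
    (a : V) : A.ncoef k a v = 0 := by
  obtain ⟨c, rfl⟩ := W.exists_smul_vac hv
  simp [A.ncoef_vac_zero k hk]

theorem T_degree_zero (W : VOAsCFT A) {v : V} (hv : v ∈ W.gr 0) : A.T v = 0 := by
  change A.ncoef (-2) v A.vac = 0
  rw [W.ncoef_degree_zero hv (by decide), LinearMap.zero_apply]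

theorem prL_L0 (W : VOAsCFT A) (n : ℤ) (v : V) :
    W.prL n (A.ncoef 1 W.ω v) = (n : K) • W.prL n v := by
  refine W.hom_induction (p := fun v => W.prL n (A.ncoef 1 W.ω v) = (n : K) • W.prL n v)
    ?_ (by simp) (fun v w hv hw => by simp [hv, hw]) v
  intro m v hv
  rw [W.L0_grading m v hv, map_smul]
  rcases eq_or_ne m n with rfl | h
  · rfl
  · rw [W.prL_of_mem_ne hv h, smul_zero, smul_zero]

theorem T_ncoef (W : VOAsCFT A) (k : ℤ) (a b : V) :
    A.T (A.ncoef k a b) = A.ncoef k (A.T a) b + A.ncoef k a (A.T b) := by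
  rw [← W.Lneg1_eq_T, A.ncoef_zero_comm]

theorem mem_gr_zero_of_mem_le (W : VOAsCFT A) {v : V} (hv : v ∈ W.toGradedVA.le 0) :
    v ∈ W.gr 0 := by
  have h := W.eq_zero_of_mem_le (by norm_num) (W.sub_prL_mem_le hv)
  rw [sub_eq_zero.1 h]
  exact W.prL_mem 0 v

theorem exists_components (W : VOAsCFT A) {x : V} (hx : x ∈ W.toGradedVA.le 2) :
    ∃ x₀ ∈ W.gr 0, ∃ x₁ ∈ W.gr 1, ∃ x₂ ∈ W.gr 2, x = x₀ + x₁ + x₂ := by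
  have h1 := W.sub_prL_mem_le hx
  rw [show (2 : ℤ) - 1 = 1 from rfl] at h1
  have h2 := W.sub_prL_mem_le h1
  rw [sub_self] at h2
  exact ⟨_, W.mem_gr_zero_of_mem_le h2, _, W.prL_mem 1 _, _, W.prL_mem 2 x, by abel⟩

variable [CharZero K]

theorem mem_gr_of_L0 (W : VOAsCFT A) {n : ℤ} {v : V} (h : A.ncoef 1 W.ω v = (n : K) • v) :
    v ∈ W.gr n := by
  have : v - W.prL n v = 0 := by
    refine W.eq_zero_of_forall_prL fun k => ?_
    rcases eq_or_ne n k with rfl | hk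
    · rw [map_sub, W.prL_of_mem (W.prL_mem n v), sub_self]
    · rw [map_sub, W.prL_of_mem_ne (W.prL_mem n v) hk, sub_zero]
      have h1 := W.prL_L0 k v
      rw [h, map_smul, ← sub_eq_zero, ← sub_smul, smul_eq_zero, sub_eq_zero] at h1
      exact h1.resolve_left fun h2 => hk (by exact_mod_cast h2)
  rw [sub_eq_zero.1 this]
  exact W.prL_mem n v

theorem L1_omega (W : VOAsCFT A) : A.ncoef 2 W.ω W.ω = 0 := by
  obtain ⟨c, hc⟩ := W.virasoro
  have h := LinearMap.congr_fun (hc 1 (-2)) A.vac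
  norm_num [A.ncoef_vac, A.ncoef_vac_zero] at h
  exact h

theorem L1_T (W : VOAsCFT A) {b : V} (hb : b ∈ W.gr 1) : A.ncoef 2 W.ω (A.T b) = (2 : K) • b := by
  obtain ⟨c, hc⟩ := W.virasoro
  have h := LinearMap.congr_fun (hc 1 (-1)) b
  norm_num [W.L1_V1 b hb, W.L0_grading 1 b hb, W.Lneg1_eq_T] at h
  exact h

theorem ncoef_one_omega (W : VOAsCFT A) {a : V} (ha : a ∈ W.gr 1) : A.ncoef 1 a W.ω = a := by
  rw [A.skew W.ω a 1 1]
  · simp [A.ncoef_vac, W.L0_grading 1 a ha]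
  · intro i hi
    rcases hi.eq_or_lt with rfl | hi
    · exact W.L1_V1 a ha
    · exact W.ncoef_eq_zero W.ω_mem ha (by omega)

theorem ncoef_two_omega (W : VOAsCFT A) {a : V} (ha : a ∈ W.gr 1) : A.ncoef 2 a W.ω = 0 := by
  rw [A.skew W.ω a 2 1]
  · simp [W.L1_V1 a ha]
  · intro i hi
    exact W.ncoef_eq_zero W.ω_mem ha (by omega)

theorem ncoef_one_comm (W : VOAsCFT A) {a b : V} (ha : a ∈ W.gr 1) (hb : b ∈ W.gr 1) :
    A.ncoef 1 a b = A.ncoef 1 b a := by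
  rw [A.skew b a 1 1]
  · simp [A.ncoef_vac]
  · intro i hi
    exact W.ncoef_eq_zero hb ha (by omega)

theorem ncoef_T_right (W : VOAsCFT A) (k : ℤ) (a b : V) :
    A.ncoef k a (A.T b) = A.T (A.ncoef k a b) + (k : K) • A.ncoef (k - 1) a b := by
  rw [W.T_ncoef, A.ncoef_T, neg_smul]
  abel

/-- A vector of degree two with vanishing zeroth mode is a derivative up to the kernel of `T`. -/
theorem T_sub_eq_zero (W : VOAsCFT A) {y : V} (hy : y ∈ W.gr 2) (h : A.ncoef 0 y = 0) :
    A.T (y - A.T ((2 : K)⁻¹ • A.ncoef 2 W.ω y)) = 0 := by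
  have hs := A.skew W.ω y 0 4 fun i hi => W.ncoef_eq_zero W.ω_mem hy (by omega)
  have h3 : A.ncoef (-4) (A.ncoef 3 W.ω y) A.vac = 0 := by
    rw [W.ncoef_degree_zero (W.ncoef_mem_of_eq W.ω_mem hy (by ring)) (by decide),
      LinearMap.zero_apply]
  have h2 : (2 : K) • A.ncoef (-3) (A.ncoef 2 W.ω y) A.vac = A.T (A.T (A.ncoef 2 W.ω y)) := by
    have := A.T_pow 2 (A.ncoef 2 W.ω y)
    norm_num [pow_two] at this
    exact this.symm
  have h1 : A.ncoef (-2) (A.ncoef 1 W.ω y) A.vac = (2 : K) • A.T y := by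
    rw [W.L0_grading 2 y hy]
    simp [VA.T]
  simp only [Finset.sum_range_succ, Finset.sum_range_zero] at hs
  norm_num [h, A.ncoef_vac, W.Lneg1_eq_T, h1, h3] at hs
  rw [map_sub, map_smul, map_smul, ← h2, smul_smul, inv_mul_cancel₀ two_ne_zero, one_smul]
  linear_combination (norm := module) (-1 : K) • hs

end General

section Real

variable {V : Type*} [AddCommGroup V] [Module ℝ V] {A : VA ℝ V}

theorem form_L1 (W : VOAsCFT A) {B : V →ₗ[ℝ] V →ₗ[ℝ] ℝ} (hB : W.IsInvForm B) (b c : V) :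
    B (A.ncoef 2 W.ω b) c = B b (A.T c) := by
  have h := hB 2 W.ω W.ω_mem b c 2
  rw [finsum_eq_single _ 0] at h
  · have hs : ((2 : ℤ).negOnePow : ℤ) = 1 := by decide
    norm_num [hs, W.Lneg1_eq_T] at h
    exact h
  · intro i hi
    obtain ⟨k, rfl⟩ := Nat.exists_eq_succ_of_ne_zero hi
    have h0 : (A.ncoef 2 W.ω ^ (k + 1)) W.ω = 0 := by
      rw [pow_succ, Module.End.mul_apply, W.L1_omega, map_zero]
    rw [Nat.succ_eq_add_one, h0]
    simp

theorem form_L1_pow (W : VOAsCFT A) {B : V →ₗ[ℝ] V →ₗ[ℝ] ℝ} (hB : W.IsInvForm B) (j : ℕ)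
    (b c : V) : B ((A.ncoef 2 W.ω ^ j) b) c = B b ((A.T ^ j) c) := by
  induction j generalizing b with
  | zero => rfl
  | succ j ih =>
    rw [pow_succ, Module.End.mul_apply, ih, W.form_L1 hB, pow_succ', Module.End.mul_apply]

theorem L1_pow_mem (W : VOAsCFT A) {n : ℤ} {u : V} (hu : u ∈ W.gr n) (j : ℕ) :
    (A.ncoef 2 W.ω ^ j) u ∈ W.gr (n - j) := by
  induction j with
  | zero => simpa using hu
  | succ j ih =>
    rw [pow_succ', Module.End.mul_apply]
    exact W.ncoef_mem_of_eq W.ω_mem ih (by push_cast; ring)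

/-- With respect to a positive-definite invariant form, a nonzero homogeneous vector pairs
nontrivially with itself into the vacuum. -/
theorem ncoef_self_ne_zero (W : VOAsCFT A) {B : V →ₗ[ℝ] V →ₗ[ℝ] ℝ} (hB : W.IsInvForm B)
    (hp : ∀ v : V, v ≠ 0 → 0 < B v v) {M : ℤ} {u : V} (hu : u ∈ W.gr M) (h0 : u ≠ 0) :
    A.ncoef (2 * M - 1) u u ≠ 0 := by
  intro h
  have hnn : ∀ v, 0 ≤ B v v := fun v => by
    rcases eq_or_ne v 0 with rfl | hv
    · simp
    · exact (hp v hv).le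
  have hf := hB M u hu u A.vac (2 * M - 1)
  have hterm : ∀ j : ℕ, (Nat.factorial j : ℝ)⁻¹ *
      B u (A.ncoef (2 * M - (2 * M - 1) - 2 - (j : ℤ)) ((A.ncoef 2 W.ω ^ j) u) A.vac) =
      (Nat.factorial j : ℝ)⁻¹ * ((Nat.factorial j : ℝ)⁻¹ *
        B ((A.ncoef 2 W.ω ^ j) u) ((A.ncoef 2 W.ω ^ j) u)) := by
    intro j
    rw [W.form_L1_pow hB, A.T_pow, map_smul, smul_eq_mul,
      inv_mul_cancel_left₀ (by exact_mod_cast j.factorial_ne_zero)]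
    congr 5
    ring
  rw [h, map_zero, LinearMap.zero_apply, eq_comm, mul_eq_zero] at hf
  have hf' := hf.resolve_left (by simp)
  have hf'' := (finsum_congr hterm).symm.trans hf'
  rw [finsum_eq_sum_of_support_subset (s := Finset.range (M.toNat + 1))] at hf''
  · refine (Finset.sum_pos' (fun i _ => ?_) ⟨0, by simp, ?_⟩).ne' hf''
    · have := hnn ((A.ncoef 2 W.ω ^ i) u)
      positivity
    · simpa using hp u h0
  · intro j hj
    by_contra hj'
    refine hj ?_
    have : (A.ncoef 2 W.ω ^ j) u = 0 :=
      W.eq_zero_of_neg (by simp at hj'; omega) (W.L1_pow_mem hu j)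
    change _ * (_ * B _ _) = 0
    simp [this]

theorem eq_zero_of_T_eq_zero (W : VOAsCFT A) {B : V →ₗ[ℝ] V →ₗ[ℝ] ℝ} (hB : W.IsInvForm B)
    (hp : ∀ v : V, v ≠ 0 → 0 < B v v) {n : ℤ} (hn : n ≠ 0) {u : V} (hu : u ∈ W.gr n)
    (h : A.T u = 0) : u = 0 := by
  by_contra h0
  refine W.ncoef_self_ne_zero hB hp hu h0 ?_
  have h1 := A.ncoef_T u u (2 * n)
  rw [h, map_zero, LinearMap.zero_apply, eq_comm, smul_eq_zero] at h1
  exact h1.resolve_left (by simpa using hn)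

theorem exists_eq_T (W : VOAsCFT A) {B : V →ₗ[ℝ] V →ₗ[ℝ] ℝ} (hB : W.IsInvForm B)
    (hp : ∀ v : V, v ≠ 0 → 0 < B v v) {y : V} (hy : y ∈ W.gr 2) (h : A.ncoef 0 y = 0) :
    ∃ b ∈ W.gr 1, y = A.T b := by
  have hb : (2 : ℝ)⁻¹ • A.ncoef 2 W.ω y ∈ W.gr 1 :=
    Submodule.smul_mem _ _ (W.ncoef_mem_of_eq W.ω_mem hy (by ring))
  exact ⟨_, hb, sub_eq_zero.1 (W.eq_zero_of_T_eq_zero hB hp two_ne_zero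
    (sub_mem hy (W.T_mem hb)) (W.T_sub_eq_zero hy h))⟩

theorem form_zero_mode (W : VOAsCFT A) {B : V →ₗ[ℝ] V →ₗ[ℝ] ℝ} (hB : W.IsInvForm B) {b : V}
    (hb : b ∈ W.gr 1) (v w : V) : B (A.ncoef 0 b v) w = -B v (A.ncoef 0 b w) := by
  have h := hB 1 b hb v w 0
  rw [finsum_eq_single _ 0] at h
  · simpa using h
  · intro i hi
    obtain ⟨k, rfl⟩ := Nat.exists_eq_succ_of_ne_zero hi
    have h0 : (A.ncoef 2 W.ω ^ (k + 1)) b = 0 := by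
      rw [pow_succ, Module.End.mul_apply, W.L1_V1 b hb, map_zero]
    rw [Nat.succ_eq_add_one, h0]
    simp

end Real

end VOAsCFT

namespace VA

variable {K V : Type*} [Field K] [AddCommGroup V] [Module K V]

theorem mem_eig (A : VA K V) {a v : V} {n : ℤ} :
    v ∈ A.eig a n ↔ A.ncoef 1 a v = (n : K) • v := by
  simp [eig, sub_eq_zero]

theorem isInternal_eig [CharZero K] (A : VA K V) {a : V} (h : ⨆ n, A.eig a n = ⊤) :
    DirectSum.IsInternal (A.eig a) := by
  refine DirectSum.isInternal_submodule_of_iSupIndep_of_iSup_eq_top ?_ h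
  have h1 := (Module.End.eigenspaces_iSupIndep (A.ncoef 1 a)).comp
    (f := fun n : ℤ => (n : K)) Int.cast_injective
  convert h1 using 1
  ext n v
  rw [mem_eig]
  simp

namespace IsVAHom

variable {A : VA K V}

/-- A vertex algebra homomorphism as a linear map. -/
def toLinearMap {f : V → V} (hf : A.IsVAHom f) : V →ₗ[K] V where
  toFun := f
  map_add' := hf.map_add
  map_smul' := hf.map_smul

theorem map_T {f : V → V} (hf : A.IsVAHom f) (v : V) : f (A.T v) = A.T (f v) := by
  change f (A.ncoef (-2) v A.vac) = A.ncoef (-2) (f v) A.vac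
  rw [hf.map_ncoef, hf.map_vac]

theorem comp {f g : V → V} (hf : A.IsVAHom f) (hg : A.IsVAHom g) : A.IsVAHom (f ∘ g) where
  map_add a b := by simp [hf.map_add, hg.map_add]
  map_smul c a := by simp [hf.map_smul, hg.map_smul]
  map_ncoef n a b := by simp [hf.map_ncoef, hg.map_ncoef]
  map_vac := by simp [hf.map_vac, hg.map_vac]

end IsVAHom

variable {A : VA K V}

theorem IsVAAut.comp {f g : V → V} (hf : A.IsVAAut f) (hg : A.IsVAAut g) : A.IsVAAut (f ∘ g) :=
  ⟨hf.1.comp hg.1, hf.2.comp hg.2⟩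

theorem IsVAAut.exists_inverse {f : V → V} (hf : A.IsVAAut f) :
    ∃ g, A.IsVAAut g ∧ (∀ v, g (f v) = v) ∧ ∀ v, f (g v) = v := by
  obtain ⟨g, hgf, hfg⟩ := Function.bijective_iff_has_inverse.1 hf.2
  refine ⟨g, ⟨⟨fun a b => ?_, fun c a => ?_, fun n a b => ?_, ?_⟩,
    hfg.injective, hgf.surjective⟩, hgf, hfg⟩
  · exact hf.2.1 (by rw [hf.1.map_add, hfg, hfg, hfg])
  · exact hf.2.1 (by rw [hf.1.map_smul, hfg, hfg])
  · exact hf.2.1 (by rw [hf.1.map_ncoef, hfg, hfg, hfg])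
  · exact hf.2.1 (by rw [hf.1.map_vac, hfg])

/-- Vertex algebra automorphisms permute the conformal vectors. -/
theorem IsConformal.map [CharZero K] {f : V → V} (hf : A.IsVAAut f) {x : V}
    (hx : A.IsConformal x) : A.IsConformal (f x) := by
  obtain ⟨h1, ⟨c, h3⟩, h2, h4, h0, hi⟩ := hx
  have hz : f 0 = 0 := hf.1.toLinearMap.map_zero
  refine ⟨?_, ⟨c, ?_⟩, ?_, fun n hn => ?_, ?_, ?_⟩
  · rw [← hf.1.map_ncoef, h1, hf.1.map_smul]
  · rw [← hf.1.map_ncoef, h3, hf.1.map_smul, hf.1.map_vac]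
  · rw [← hf.1.map_ncoef, h2, hz]
  · rw [← hf.1.map_ncoef, h4 n hn, hz]
  · ext v
    obtain ⟨u, rfl⟩ := hf.2.2 v
    rw [← hf.1.map_ncoef, h0, hf.1.map_T]
  · refine A.isInternal_eig (eq_top_iff.2 fun v _ => ?_)
    obtain ⟨u, rfl⟩ := hf.2.2 v
    have hu : u ∈ ⨆ n, A.eig x n := by rw [hi.submodule_iSup_eq_top]; trivial
    refine Submodule.iSup_induction (motive := fun u => f u ∈ ⨆ n, A.eig (f x) n) _ hu
      (fun n u hu => Submodule.mem_iSup_of_mem n ?_) (by rw [hz]; exact zero_mem _)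
      (fun u w hu hw => by rw [hf.1.map_add]; exact add_mem hu hw)
    rw [mem_eig] at hu ⊢
    rw [← hf.1.map_ncoef, hu, hf.1.map_smul]

end VA

namespace GradedVA

variable {K V : Type*} [Field K] [AddCommGroup V] [Module K V] {A : VA K V}

theorem AutMinus.sub_mem_le {G : GradedVA A} {k : V → V} (hk : G.AutMinus k) {n : ℤ} {v : V}
    (hv : v ∈ G.le n) : k v - v ∈ G.le (n - 1) := by
  have h0 : k 0 = 0 := hk.1.1.toLinearMap.map_zero
  refine G.le_induction (p := fun v => k v - v ∈ G.le (n - 1)) (fun i hi v hv => ?_)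
    (by rw [h0, sub_zero]; exact zero_mem _) (fun v w hv hw => ?_) hv
  · obtain ⟨h1, h2⟩ := hk.2 i v hv
    have h3 := G.sub_prL_mem_le h1
    rw [prL_apply, h2] at h3
    exact G.le_mono (by omega) h3
  · rw [hk.1.1.map_add, add_sub_add_comm]
    exact add_mem hv hw

end GradedVA

namespace VOAsCFT

section General

variable {K V : Type*} [Field K] [CharZero K] [AddCommGroup V] [Module K V] {A : VA K V}

/-- Exponentiating `a(1)` carries `L(0)`-eigenvectors to eigenvectors of `L(0) + a(1)`. -/
theorem iSup_eig_eq_top (W : VOAsCFT A) {a x : V} (ha : a ∈ W.gr 1)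
    (hx : ∀ v, A.ncoef 1 x v = A.ncoef 1 a v + A.ncoef 1 W.ω v) : ⨆ n, A.eig x n = ⊤ := by
  have hD : ∀ (n : ℤ) (v : V), v ∈ W.gr n → ∀ j : ℕ, (A.ncoef 1 a ^ j) v ∈ W.gr (n - j) := by
    intro n v hv j
    induction j with
    | zero => simpa using hv
    | succ j ih =>
      rw [pow_succ', Module.End.mul_apply]
      exact W.ncoef_mem_of_eq ha ih (by push_cast; ring)
  have hexp : ∀ (n : ℤ) (v : V), v ∈ W.gr n → ∀ N : ℕ,
      A.ncoef 1 x (∑ j ∈ Finset.range (N + 1), (j.factorial : K)⁻¹ • (A.ncoef 1 a ^ j) v) =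
      (n : K) • (∑ j ∈ Finset.range (N + 1), (j.factorial : K)⁻¹ • (A.ncoef 1 a ^ j) v) +
        (N.factorial : K)⁻¹ • (A.ncoef 1 a ^ (N + 1)) v := by
    intro n v hv N
    induction N with
    | zero => simp [hx, W.L0_grading n v hv, add_comm]
    | succ N ih =>
      have hN : ((N + 1 : ℕ) : K) ≠ 0 := by exact_mod_cast N.succ_ne_zero
      have hf : (N.factorial : K) ≠ 0 := by exact_mod_cast N.factorial_ne_zero
      have hs : (N.factorial : K)⁻¹ = ((N + 1 : ℕ) : K) * ((N + 1).factorial : K)⁻¹ := by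
        rw [Nat.factorial_succ]
        push_cast at hN ⊢
        field_simp
      rw [Finset.sum_range_succ, map_add, ih, map_smul, hx, W.L0_grading _ _ (hD n v hv (N + 1)),
        ← Module.End.mul_apply, ← pow_succ', hs]
      push_cast
      module
  have hle : ∀ (k : ℕ) (v : V), v ∈ W.toGradedVA.le ((k : ℤ) - 1) → v ∈ ⨆ n, A.eig x n := by
    intro k
    induction k with
    | zero =>
      intro v hv
      rw [W.eq_zero_of_mem_le (by norm_num) hv]
      exact zero_mem _
    | succ k ih =>
      intro v hv
      have hv1 := W.sub_prL_mem_le hv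
      have hw := W.prL_mem (((k + 1 : ℕ) : ℤ) - 1) v
      generalize W.prL (((k + 1 : ℕ) : ℤ) - 1) v = w at hv1 hw
      have he := hexp _ w hw k
      have h0 : (A.ncoef 1 a ^ (k + 1)) w = 0 :=
        W.eq_zero_of_neg (by push_cast; omega) (hD _ w hw (k + 1))
      rw [h0, smul_zero, add_zero] at he
      have hS := Submodule.mem_iSup_of_mem (p := A.eig x) _ (A.mem_eig.2 he)
      have hr : (∑ j ∈ Finset.range (k + 1), (j.factorial : K)⁻¹ • (A.ncoef 1 a ^ j) w) - w ∈
          W.toGradedVA.le ((k : ℤ) - 1) := by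
        rw [Finset.sum_range_succ']
        simp only [Nat.factorial_zero, Nat.cast_one, inv_one, pow_zero, one_smul,
          Module.End.one_apply, add_sub_cancel_right]
        exact Submodule.sum_mem _ fun j _ => Submodule.smul_mem _ _
          (W.gr_le_le (by push_cast; omega) (hD _ w hw (j + 1)))
      have h1 := ih _ hr
      have h2 := ih _ (W.le_mono (by push_cast; omega) hv1)
      have h3 := sub_mem (add_mem h2 hS) h1
      convert h3 using 1
      abel
  refine eq_top_iff.2 fun v _ => ?_
  obtain ⟨n, hn⟩ := W.exists_mem_le v
  exact hle (n + 1).toNat v (W.le_mono (by omega) hn)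

theorem isConformal_of_J1 (W : VOAsCFT A) {a b : V} (ha : a ∈ W.J1) (hb : b ∈ W.J1) :
    A.IsConformal ((2 : K)⁻¹ • A.ncoef 1 a a + a + W.ω + A.T b) := by
  obtain ⟨ha1, ha0⟩ := ha
  obtain ⟨hb1, hb0⟩ := hb
  have h0 : (2 : K)⁻¹ • A.ncoef 1 a a ∈ W.gr 0 :=
    Submodule.smul_mem _ _ (W.ncoef_mem_of_eq ha1 ha1 (by ring))
  have hTb : A.T b ∈ W.gr 2 := W.T_mem hb1
  have hab : A.ncoef 1 a b ∈ W.gr 0 := W.ncoef_mem_of_eq ha1 hb1 (by ring)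
  have hbb : A.ncoef 1 b b ∈ W.gr 0 := W.ncoef_mem_of_eq hb1 hb1 (by ring)
  have hmode : ∀ k : ℤ, 0 ≤ k → ∀ v,
      A.ncoef k ((2 : K)⁻¹ • A.ncoef 1 a a + a + W.ω + A.T b) v =
        A.ncoef k a v + A.ncoef k W.ω v - (k : K) • A.ncoef (k - 1) b v := by
    intro k hk v
    rw [map_add, map_add, map_add, W.ncoef_degree_zero h0 (by omega)]
    simp only [LinearMap.add_apply, LinearMap.zero_apply, A.ncoef_T]
    module
  have hle : (2 : K)⁻¹ • A.ncoef 1 a a + a + W.ω + A.T b ∈ W.toGradedVA.le 2 :=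
    add_mem (add_mem (add_mem (W.gr_le_le (by norm_num) h0) (W.gr_le_le (by norm_num) ha1))
      (W.gr_le_le le_rfl W.ω_mem)) (W.gr_le_le le_rfl hTb)
  refine ⟨?_, ?_, ?_, fun n hn => ?_, ?_, ?_⟩
  · rw [hmode 1 (by norm_num)]
    simp only [sub_self, hb0, LinearMap.zero_apply, smul_zero, map_add,
      W.ncoef_apply_degree_zero h0 zero_le_one, W.ncoef_one_omega ha1, W.ncoef_T_right,
      W.T_degree_zero hab, ha0, W.L0_grading 1 a ha1, W.L0_grading 2 _ W.ω_mem,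
      W.L0_grading 1 b hb1, W.Lneg1_eq_T, map_smul]
    push_cast
    module
  · have h3 := W.ncoef_mem_le 3 hle hle
    rw [show (2 : ℤ) + 2 - 3 - 1 = 0 from rfl] at h3
    obtain ⟨c, hc⟩ := W.exists_smul_vac (W.mem_gr_zero_of_mem_le h3)
    exact ⟨c, hc.symm⟩
  · rw [hmode 2 (by norm_num)]
    have haa : A.ncoef 2 a a = 0 := W.ncoef_eq_zero ha1 ha1 (by norm_num)
    have hab2 : A.ncoef 2 a b = 0 := W.ncoef_eq_zero ha1 hb1 (by norm_num)
    have e : (2 : ℤ) - 1 = 1 := rfl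
    simp only [e, map_add, W.ncoef_apply_degree_zero h0 zero_le_one,
      W.ncoef_apply_degree_zero h0 zero_le_two, W.L1_V1 a ha1, W.L1_omega, W.L1_T hb1,
      haa, W.ncoef_two_omega ha1, W.ncoef_one_omega hb1, W.ncoef_T_right, hab2, map_zero,
      W.T_degree_zero hbb, sub_self, hb0, LinearMap.zero_apply, W.ncoef_one_comm ha1 hb1]
    push_cast
    module
  · exact W.eq_zero_of_mem_le (by omega) (W.ncoef_mem_le n hle hle)
  · ext v
    rw [hmode 0 le_rfl, ha0, W.Lneg1_eq_T]
    simp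
  · refine A.isInternal_eig (W.iSup_eig_eq_top ha1 fun v => ?_)
    rw [hmode 1 zero_le_one, sub_self, hb0]
    simp

end General

end VOAsCFT

namespace VOAsCFT

variable {V : Type*} [AddCommGroup V] [Module ℝ V] {A : VA ℝ V}

/-- A conformal vector has no component of degree greater than two. -/
theorem isConformal_mem_le (W : VOAsCFT A) {B : V →ₗ[ℝ] V →ₗ[ℝ] ℝ} (hB : W.IsInvForm B)
    (hp : ∀ v : V, v ≠ 0 → 0 < B v v) {x : V} (hx : A.IsConformal x) :
    x ∈ W.toGradedVA.le 2 := by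
  by_contra h
  obtain ⟨M, hM, hxM, h0⟩ := W.exists_top_of_not_mem_le h
  refine W.ncoef_self_ne_zero hB hp (W.prL_mem M x) h0 ?_
  have h1 := W.prL_ncoef (k := 2 * M - 1) (l := 0) (by ring) hxM hxM
  rw [← h1, hx.2.2.2.1 _ (by omega), map_zero]

/-- If `L(0) + a(1) - b(0)` is diagonalizable over `ℝ`, with `a` and `b` of degree one, then the
skew-adjoint operator `b(0)` vanishes. -/
theorem zero_mode_eq_zero (W : VOAsCFT A) {B : V →ₗ[ℝ] V →ₗ[ℝ] ℝ} (hB : W.IsInvForm B)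
    (hp : ∀ v : V, v ≠ 0 → 0 < B v v) {a b x : V} (ha : a ∈ W.gr 1) (hb : b ∈ W.gr 1)
    (hx : ∀ v, A.ncoef 1 x v = A.ncoef 1 a v + A.ncoef 1 W.ω v - A.ncoef 0 b v)
    (htop : ⨆ n, A.eig x n = ⊤) : A.ncoef 0 b = 0 := by
  have hskew : ∀ (c : ℝ) (z : V), A.ncoef 0 b z = c • z → A.ncoef 0 b z = 0 := by
    intro c z hz
    have h := W.form_zero_mode hB hb z z
    rw [hz, map_smul, map_smul, LinearMap.smul_apply, smul_eq_mul] at h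
    rcases eq_or_ne z 0 with rfl | hz0
    · simp
    · have := hp z hz0
      have hc : c = 0 := by
        have h' : c * B z z = 0 := by linarith
        exact (mul_eq_zero.1 h').resolve_right this.ne'
      rw [hz, hc, zero_smul]
  have hsq : ∀ z : V, A.ncoef 0 b (A.ncoef 0 b z) = 0 → A.ncoef 0 b z = 0 := by
    intro z hz
    by_contra h0
    have h := W.form_zero_mode hB hb z (A.ncoef 0 b z)
    rw [hz, map_zero, neg_zero] at h
    exact (hp _ h0).ne' h
  have key : ∀ (n : ℤ) (s : Finset ℤ) (w : ℤ → V), (∀ k ∈ s, w k ∈ A.eig x k) →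
      ∑ k ∈ s, w k ∈ W.toGradedVA.le n → A.ncoef 0 b (W.prL n (∑ k ∈ s, w k)) = 0 := by
    intro n s
    induction s using Finset.induction_on with
    | empty => intro w _ _; simp
    | insert k₀ s hk₀ ih =>
      intro w hw hle
      set v := ∑ k ∈ insert k₀ s, w k with hv
      have hv' : A.ncoef 1 x v - (k₀ : ℝ) • v = ∑ k ∈ s, ((k : ℝ) - k₀) • w k := by
        have h1 : ∀ k ∈ insert k₀ s, A.ncoef 1 x (w k) = (k : ℝ) • w k :=
          fun k hk => A.mem_eig.1 (hw k hk)
        rw [hv, map_sum, Finset.sum_congr rfl h1, Finset.smul_sum, ← Finset.sum_sub_distrib,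
          Finset.sum_insert hk₀, sub_self, zero_add]
        exact Finset.sum_congr rfl fun k _ => (sub_smul _ _ _).symm
      have ha' := W.ncoef_mem_le 1 (W.gr_le_le le_rfl ha) hle
      have hω' := W.ncoef_mem_le 1 (W.gr_le_le le_rfl W.ω_mem) hle
      have hb' := W.ncoef_mem_le 0 (W.gr_le_le le_rfl hb) hle
      rw [show 2 + n - 1 - 1 = n by ring] at hω'
      rw [show 1 + n - 0 - 1 = n by ring] at hb'
      have hmem : A.ncoef 1 x v - (k₀ : ℝ) • v ∈ W.toGradedVA.le n := by
        rw [hx]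
        exact sub_mem (sub_mem (add_mem (W.le_mono (by omega) ha') hω') hb')
          (Submodule.smul_mem _ _ hle)
      have hpr : W.prL n (A.ncoef 1 x v - (k₀ : ℝ) • v) =
          ((n : ℝ) - k₀) • W.prL n v - A.ncoef 0 b (W.prL n v) := by
        rw [hx, map_sub, map_sub, map_add, W.prL_of_mem_le (by omega) ha', W.prL_L0,
          W.prL_ncoef (m := 1) (n := n) (k := 0) (by ring) (W.gr_le_le le_rfl hb) hle,
          W.prL_of_mem hb, map_smul, sub_smul]
        abel
      have hi := ih (fun k => ((k : ℝ) - k₀) • w k)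
        (fun k hk => Submodule.smul_mem _ _ (hw k (Finset.mem_insert_of_mem hk)))
        (hv' ▸ hmem)
      rw [← hv', hpr, map_sub, map_smul, sub_eq_zero] at hi
      exact hsq _ (hskew _ _ hi.symm)
  refine W.linearMap_ext fun n v hv => ?_
  have hv' : v ∈ ⨆ n, A.eig x n := htop ▸ Submodule.mem_top
  obtain ⟨f, hf, hs⟩ := (Submodule.mem_iSup_iff_exists_finsupp _ _).1 hv'
  have h := key n f.support f (fun k _ => hf k)
  change f.sum (fun _ y => y) ∈ _ → A.ncoef 0 b (W.prL n (f.sum fun _ y => y)) = 0 at h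
  rw [hs, W.prL_of_mem hv] at h
  rw [h (W.gr_le_le le_rfl hv), LinearMap.zero_apply]

theorem exists_J1_of_isConformal (W : VOAsCFT A) {B : V →ₗ[ℝ] V →ₗ[ℝ] ℝ} (hB : W.IsInvForm B)
    (hp : ∀ v : V, v ≠ 0 → 0 < B v v) {x : V} (hx : A.IsConformal x) :
    ∃ a ∈ W.J1, ∃ b ∈ W.J1, x = (2 : ℝ)⁻¹ • A.ncoef 1 a a + a + W.ω + A.T b := by
  obtain ⟨x₀, h0, x₁, h1, x₂, h2, rfl⟩ := W.exists_components (W.isConformal_mem_le hB hp hx)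
  obtain ⟨hxx, -, -, -, hT, hi⟩ := hx
  have hsplit : ∀ n : ℤ, ∀ v ∈ W.gr n, A.ncoef 0 x₁ v = 0 ∧ A.ncoef 0 x₂ v = A.T v := by
    intro n v hv
    have h := LinearMap.congr_fun hT v
    rw [map_add, map_add, W.ncoef_degree_zero h0 (by decide), zero_add,
      LinearMap.add_apply] at h
    have hz : A.ncoef 0 x₁ v = 0 := by
      refine W.eq_zero_of_mem_of_mem (n := n) (m := n + 1) (by omega)
        (W.ncoef_mem_of_eq h1 hv (by ring)) ?_
      rw [eq_sub_of_add_eq h]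
      exact sub_mem (W.T_mem hv) (W.ncoef_mem_of_eq h2 hv (by ring))
    exact ⟨hz, by rwa [hz, zero_add] at h⟩
  have ha0 : A.ncoef 0 x₁ = 0 := W.linearMap_ext fun n v hv => by
    rw [(hsplit n v hv).1, LinearMap.zero_apply]
  have hy0 : A.ncoef 0 (x₂ - W.ω) = 0 := W.linearMap_ext fun n v hv => by
    rw [map_sub, LinearMap.sub_apply, (hsplit n v hv).2, W.Lneg1_eq_T, sub_self,
      LinearMap.zero_apply]
  obtain ⟨b, hb, hyb⟩ := W.exists_eq_T hB hp (sub_mem h2 W.ω_mem) hy0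
  obtain rfl : x₂ = W.ω + A.T b := by rw [← hyb]; abel
  have hmode : ∀ v, A.ncoef 1 (x₀ + x₁ + (W.ω + A.T b)) v =
      A.ncoef 1 x₁ v + A.ncoef 1 W.ω v - A.ncoef 0 b v := by
    intro v
    rw [map_add, map_add, W.ncoef_degree_zero h0 (by decide), map_add]
    simp only [LinearMap.add_apply, LinearMap.zero_apply, A.ncoef_T]
    norm_num
    abel
  have hb0 := W.zero_mode_eq_zero hB hp h1 hb hmode hi.submodule_iSup_eq_top
  refine ⟨x₁, ⟨h1, ha0⟩, b, ⟨hb, hb0⟩, ?_⟩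
  have h11 : A.ncoef 1 x₁ b ∈ W.gr 0 := W.ncoef_mem_of_eq h1 hb (by ring)
  rw [hmode] at hxx
  simp only [hb0, map_add, LinearMap.zero_apply, W.ncoef_apply_degree_zero h0 zero_le_one,
    W.ncoef_one_omega h1, W.ncoef_T_right, W.T_degree_zero h11, sub_self, ha0,
    W.L0_grading 1 x₁ h1, W.L0_grading 2 _ W.ω_mem, W.L0_grading 1 b hb, W.Lneg1_eq_T,
    map_smul] at hxx
  have hx0 : x₀ = (2 : ℝ)⁻¹ • A.ncoef 1 x₁ x₁ := by
    push_cast at hxx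
    linear_combination (norm := module) (-(2 : ℝ)⁻¹) • hxx
  rw [← hx0]
  abel

/-- Vertex algebra endomorphisms preserve the filtration by degree. -/
theorem isVAHom_mem_le (W : VOAsCFT A) {B : V →ₗ[ℝ] V →ₗ[ℝ] ℝ} (hB : W.IsInvForm B)
    (hp : ∀ v : V, v ≠ 0 → 0 < B v v) {f : V → V} (hf : A.IsVAHom f) {n : ℤ} {v : V}
    (hv : v ∈ W.toGradedVA.le n) : f v ∈ W.toGradedVA.le n := by
  have hz : f 0 = 0 := hf.toLinearMap.map_zero
  refine W.le_induction (p := fun v => f v ∈ W.toGradedVA.le n) (fun i hi v hv => ?_)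
    (by rw [hz]; exact zero_mem _) (fun v w hv hw => hf.map_add v w ▸ add_mem hv hw) hv
  refine W.le_mono hi ?_
  by_contra h
  obtain ⟨M, hM, hfM, h0⟩ := W.exists_top_of_not_mem_le h
  refine W.ncoef_self_ne_zero hB hp (W.prL_mem M (f v)) h0 ?_
  rw [← W.prL_ncoef (k := 2 * M - 1) (l := 0) (by ring) hfM hfM, ← hf.map_ncoef,
    W.ncoef_eq_zero hv hv (by omega), hz, map_zero]

theorem isVAHom_diag (W : VOAsCFT A) {B : V →ₗ[ℝ] V →ₗ[ℝ] ℝ} (hB : W.IsInvForm B)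
    (hp : ∀ v : V, v ≠ 0 → 0 < B v v) {f : V →ₗ[ℝ] V} (hf : A.IsVAHom f) :
    A.IsVAHom (W.diag f) where
  map_add := map_add _
  map_smul := map_smul _
  map_vac := by rw [W.diag_of_mem f W.vac_mem, hf.map_vac, W.prL_of_mem W.vac_mem]
  map_ncoef n a b := by
    refine W.hom_induction (p := fun a => W.diag f (A.ncoef n a b) =
      A.ncoef n (W.diag f a) (W.diag f b)) (fun i a ha => ?_) (by simp)
      (fun a a' h h' => by simp [h, h']) a
    refine W.hom_induction (p := fun b => W.diag f (A.ncoef n a b) =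
      A.ncoef n (W.diag f a) (W.diag f b)) (fun j b hb => ?_) (by simp)
      (fun b b' h h' => by simp [h, h']) b
    rw [W.diag_of_mem f (W.ncoef_mem i j n a ha b hb), W.diag_of_mem f ha, W.diag_of_mem f hb,
      hf.map_ncoef, W.prL_ncoef rfl (W.isVAHom_mem_le hB hp hf (W.gr_le_le le_rfl ha))
        (W.isVAHom_mem_le hB hp hf (W.gr_le_le le_rfl hb))]

theorem diag_diag (W : VOAsCFT A) {B : V →ₗ[ℝ] V →ₗ[ℝ] ℝ} (hB : W.IsInvForm B)
    (hp : ∀ v : V, v ≠ 0 → 0 < B v v) {f g : V →ₗ[ℝ] V} (hf : A.IsVAHom f) (hg : A.IsVAHom g)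
    (hgf : ∀ v, g (f v) = v) (v : V) : W.diag g (W.diag f v) = v := by
  refine W.hom_induction (p := fun v => W.diag g (W.diag f v) = v) (fun n v hv => ?_) (by simp)
    (fun v w hv hw => by simp [hv, hw]) v
  have h1 := W.sub_prL_mem_le (W.isVAHom_mem_le hB hp hf (W.gr_le_le le_rfl hv))
  have h2 := W.prL_of_mem_le (m := n) (by omega) (W.isVAHom_mem_le hB hp hg h1)
  rw [map_sub, map_sub, hgf, W.prL_of_mem hv, sub_eq_zero] at h2
  rw [W.diag_of_mem f hv, W.diag_of_mem g (W.prL_mem n _), ← h2]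

/-- A degree-preserving automorphism fixes the conformal vector. -/
theorem map_omega_of_graded (W : VOAsCFT A) {B : V →ₗ[ℝ] V →ₗ[ℝ] ℝ} (hB : W.IsInvForm B)
    (hp : ∀ v : V, v ≠ 0 → 0 < B v v) {h h' : V → V} (hh : A.IsVAHom h)
    (hgr : ∀ n : ℤ, ∀ v ∈ W.gr n, h v ∈ W.gr n) (hgr' : ∀ n : ℤ, ∀ v ∈ W.gr n, h' v ∈ W.gr n)
    (hhh' : ∀ v, h (h' v) = v) : h W.ω = W.ω := by
  have hy0 : A.ncoef 0 (h W.ω - W.ω) = 0 := by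
    ext v
    rw [← hhh' v, map_sub, LinearMap.sub_apply, ← hh.map_ncoef, W.Lneg1_eq_T, hh.map_T, sub_self,
      LinearMap.zero_apply]
  obtain ⟨b, hb, hyb⟩ := W.exists_eq_T hB hp (sub_mem (hgr 2 _ W.ω_mem) W.ω_mem) hy0
  have hb1 : A.ncoef 2 (h W.ω - W.ω) b = 0 := by
    rw [map_sub, LinearMap.sub_apply, W.L1_V1 b hb, sub_zero, ← hhh' b, ← hh.map_ncoef,
      W.L1_V1 _ (hgr' 1 b hb)]
    exact hh.toLinearMap.map_zero
  rw [hyb, A.ncoef_T, smul_eq_zero] at hb1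
  have hb0 : b = 0 := by
    by_contra h0
    exact W.ncoef_self_ne_zero hB hp hb h0 (hb1.resolve_left (by norm_num))
  rwa [hb0, map_zero, sub_eq_zero] at hyb

theorem autOmega_mem_gr (W : VOAsCFT A) {h : V → V} (hh : W.AutOmega h) {n : ℤ} {v : V}
    (hv : v ∈ W.gr n) : h v ∈ W.gr n := by
  refine W.mem_gr_of_L0 ?_
  rw [← hh.1.1.map_smul, ← W.L0_grading n v hv, hh.1.1.map_ncoef, hh.2]

theorem exists_factorization (W : VOAsCFT A) {B : V →ₗ[ℝ] V →ₗ[ℝ] ℝ} (hB : W.IsInvForm B)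
    (hp : ∀ v : V, v ≠ 0 → 0 < B v v) {f : V → V} (hf : A.IsVAAut f) :
    ∃ g h : V → V, W.AutMinus g ∧ W.AutOmega h ∧ f = g ∘ h := by
  obtain ⟨f', hf', hf'f, hff'⟩ := hf.exists_inverse
  have hh := W.isVAHom_diag hB hp (f := hf.1.toLinearMap) hf.1
  have hh' := W.isVAHom_diag hB hp (f := hf'.1.toLinearMap) hf'.1
  have hcomp := W.diag_diag hB hp (f := hf.1.toLinearMap) (g := hf'.1.toLinearMap) hf.1 hf'.1 hf'f
  have hcomp' := W.diag_diag hB hp (f := hf'.1.toLinearMap) (g := hf.1.toLinearMap) hf'.1 hf.1 hff'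
  have hgr : ∀ φ : V →ₗ[ℝ] V, ∀ n : ℤ, ∀ v ∈ W.gr n, W.diag φ v ∈ W.gr n := by
    intro φ n v hv
    rw [W.diag_of_mem φ hv]
    exact W.prL_mem n _
  have hbij := Function.bijective_iff_has_inverse.2 ⟨_, hcomp, hcomp'⟩
  have hbij' := Function.bijective_iff_has_inverse.2 ⟨_, hcomp', hcomp⟩
  refine ⟨f ∘ W.diag hf'.1.toLinearMap, W.diag hf.1.toLinearMap,
    ⟨hf.comp ⟨hh', hbij'⟩, fun n v hv => ?_⟩,
    ⟨⟨hh, hbij⟩, W.map_omega_of_graded hB hp hh (hgr _) (hgr _) hcomp'⟩, ?_⟩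
  · have hv' := hgr hf'.1.toLinearMap n v hv
    refine ⟨W.isVAHom_mem_le hB hp hf.1 (W.gr_le_le le_rfl hv'), ?_⟩
    have h := W.diag_of_mem hf.1.toLinearMap hv'
    rw [hcomp'] at h
    exact h.symm
  · funext v
    simp [hcomp]

theorem factorization_unique (W : VOAsCFT A) {g g' h h' : V → V} (hg : W.AutMinus g)
    (hg' : W.AutMinus g') (hh : W.AutOmega h) (hh' : W.AutOmega h') (he : g ∘ h = g' ∘ h') :
    g = g' ∧ h = h' := by
  have hhh : h = h' := by
    have : hh.1.1.toLinearMap = hh'.1.1.toLinearMap := W.linearMap_ext fun n u hu => by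
      change h u = h' u
      rw [← (hg.2 n _ (W.autOmega_mem_gr hh hu)).2, ← (hg'.2 n _ (W.autOmega_mem_gr hh' hu)).2]
      exact congrArg _ (congrFun he u)
    exact congrArg DFunLike.coe this
  subst hhh
  exact ⟨hh.1.2.2.injective_comp_right he, rfl⟩

theorem autMinus_conj (W : VOAsCFT A) {B : V →ₗ[ℝ] V →ₗ[ℝ] ℝ} (hB : W.IsInvForm B)
    (hp : ∀ v : V, v ≠ 0 → 0 < B v v) {f g k : V → V} (hf : A.IsVAAut f) (hg : A.IsVAAut g)
    (hfg : ∀ v, f (g v) = v) (hk : W.AutMinus k) : W.AutMinus (f ∘ k ∘ g) := by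
  refine ⟨hf.comp (hk.1.comp hg), fun n v hv => ?_⟩
  have h1 := hk.sub_mem_le (W.isVAHom_mem_le hB hp hg.1 (W.gr_le_le le_rfl hv))
  have h2 := W.isVAHom_mem_le hB hp hf.1 h1
  have h3 : f (k (g v) - g v) = f (k (g v)) - v := by
    have h := hf.1.toLinearMap.map_sub (k (g v)) (g v)
    change f (k (g v) - g v) = f (k (g v)) - f (g v) at h
    rwa [hfg] at h
  rw [h3] at h2
  constructor
  · have := add_mem (W.le_mono (by omega) h2) (W.gr_le_le le_rfl hv)
    rwa [sub_add_cancel] at this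
  · have h4 := W.prL_of_mem_le (m := n) (by omega) h2
    rw [map_sub, W.prL_of_mem hv, sub_eq_zero] at h4
    exact h4

end VOAsCFT

/-- Theorem `pos`: let `(V, ω)` be a simple VOA of strong CFT type
over `ℝ` whose invariant bilinear form is positive-definite. Then
`CV = {(1/2)a(1)a + a + ω + Tb | a, b ∈ J_1(V)}` and `Aut V = Aut⁻V ⋊ Aut_ω V`
(unique factorization `f = g ∘ h` with `g ∈ Aut⁻V`, `h ∈ Aut_ω V`, and `Aut⁻V` normal);
in particular, if `J_1(V) = 0`, then `CV = {ω}` and `Aut V = Aut_ω V`. -/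
theorem conformal_vectors_and_aut_posdef {V : Type*} [AddCommGroup V] [Module ℝ V]
    (A : VA ℝ V) (W : VOAsCFT A) (hs : A.IsSimple)
    (hform : ∃ B : V →ₗ[ℝ] V →ₗ[ℝ] ℝ, W.IsInvForm B ∧ ∀ v : V, v ≠ 0 → 0 < B v v) :
    ({x : V | A.IsConformal x} =
      {x : V | ∃ a ∈ W.J1, ∃ b ∈ W.J1,
        x = (2 : ℝ)⁻¹ • A.ncoef 1 a a + a + W.ω + A.T b}) ∧
    (∀ f : V → V, A.IsVAAut f →
      ∃! p : (V → V) × (V → V),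
        W.AutMinus p.1 ∧ W.AutOmega p.2 ∧ f = p.1 ∘ p.2) ∧
    (∀ f g k : V → V, A.IsVAAut f → A.IsVAAut g →
      (∀ v, g (f v) = v) → (∀ v, f (g v) = v) →
      W.AutMinus k → W.AutMinus (f ∘ k ∘ g)) ∧
    (W.J1 = {0} →
      {x : V | A.IsConformal x} = {W.ω} ∧
      ∀ f : V → V, A.IsVAAut f → f W.ω = W.ω) := by
  obtain ⟨B, hB, hp⟩ := hform
  have hCV : {x : V | A.IsConformal x} =
      {x : V | ∃ a ∈ W.J1, ∃ b ∈ W.J1,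
        x = (2 : ℝ)⁻¹ • A.ncoef 1 a a + a + W.ω + A.T b} := by
    ext x
    refine ⟨fun hx => W.exists_J1_of_isConformal hB hp hx, ?_⟩
    rintro ⟨a, ha, b, hb, rfl⟩
    exact W.isConformal_of_J1 ha hb
  refine ⟨hCV, fun f hf => ?_, fun f g k hf hg _ hfg hk => W.autMinus_conj hB hp hf hg hfg hk,
    fun hJ => ?_⟩
  · obtain ⟨g, h, hg, hh, rfl⟩ := W.exists_factorization hB hp hf
    refine ⟨(g, h), ⟨hg, hh, rfl⟩, ?_⟩
    rintro ⟨g', h'⟩ ⟨hg', hh', he⟩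
    obtain ⟨rfl, rfl⟩ := W.factorization_unique hg hg' hh hh' he
    rfl
  · have hsingle : {x : V | A.IsConformal x} = {W.ω} := by
      rw [hCV, hJ]
      ext x
      simp
    have hω : A.IsConformal W.ω := hsingle.ge (Set.mem_singleton _)
    exact ⟨hsingle, fun f hf => hsingle.le (hω.map hf)⟩
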